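/- Let U = L²((0,T); ℝ^N), H a real Hilbert space, K : U → H continuous linear, c, y^d ∈ H, α > 0, and let J(u) = (1/2)‖K u + c − y^d‖_H² + (α/2) ∫_0^T (∑_{i=1}^N |u_i(t)|)² dt. For γ > 0 let u_γ denote the unique minimizer of J_γ(u) = J(u) + (γ/2)‖u‖_U². Then for every sequence γ_n → 0 with γ_n > 0, the sequence (u_{γ_n}) converges weakly in U to a minimizer ū of J. -/

import Mathlib

open MeasureTheory Filter

section Tikhonov

variable {U : Type*} [NormedAddCommGroup U] [InnerProductSpace ℝ U]

theorem norm_half_smul_add_sq (u v : U) :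
    ‖(2⁻¹ : ℝ) • (u + v)‖ ^ 2 = (‖u‖ ^ 2 + ‖v‖ ^ 2) / 2 - ‖u - v‖ ^ 2 / 4 := by
  have h := parallelogram_law_with_norm ℝ u v
  rw [norm_smul, mul_pow]
  norm_num
  linarith

/-- A minimizer of `F + δ/2 ‖·‖²` with `F` midpoint convex satisfies a quadratic growth bound. -/
theorem quadratic_growth_of_isMinimizer {F : U → ℝ}
    (hconv : ∀ u v, F ((2⁻¹ : ℝ) • (u + v)) ≤ (F u + F v) / 2) {δ : ℝ} {u : U}
    (hu : ∀ w, F u + δ / 2 * ‖u‖ ^ 2 ≤ F w + δ / 2 * ‖w‖ ^ 2) (v : U) :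
    F u + δ / 2 * ‖u‖ ^ 2 + δ / 4 * ‖u - v‖ ^ 2 ≤ F v + δ / 2 * ‖v‖ ^ 2 := by
  have h := hu ((2⁻¹ : ℝ) • (u + v))
  rw [norm_half_smul_add_sq] at h
  linarith [hconv u v]

theorem norm_sub_sq_le_of_isMinimizer {F : U → ℝ}
    (hconv : ∀ u v, F ((2⁻¹ : ℝ) • (u + v)) ≤ (F u + F v) / 2) {γ δ : ℝ} (hγ : 0 < γ)
    (hγδ : γ ≤ δ) {u v : U}
    (hu : ∀ w, F u + γ / 2 * ‖u‖ ^ 2 ≤ F w + γ / 2 * ‖w‖ ^ 2)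
    (hv : ∀ w, F v + δ / 2 * ‖v‖ ^ 2 ≤ F w + δ / 2 * ‖w‖ ^ 2) :
    ‖u - v‖ ^ 2 ≤ 2 * (‖u‖ ^ 2 - ‖v‖ ^ 2) := by
  have h₁ := quadratic_growth_of_isMinimizer hconv hu v
  have h₂ := quadratic_growth_of_isMinimizer hconv hv u
  rw [norm_sub_rev] at h₂
  have hsum : (δ + γ) * ‖u - v‖ ^ 2 ≤ (δ - γ) * (2 * (‖u‖ ^ 2 - ‖v‖ ^ 2)) := by linarith
  rcases hγδ.eq_or_lt with rfl | hlt
  · have : ‖u - v‖ ^ 2 ≤ 0 := by nlinarith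
    have huv : u = v := by simpa [sub_eq_zero] using this.antisymm (sq_nonneg _)
    simp [huv]
  · have hD := sq_nonneg ‖u - v‖
    refine le_of_mul_le_mul_left (le_trans ?_ hsum) (sub_pos.2 hlt)
    exact mul_le_mul_of_nonneg_right (by linarith) hD

/-- Minimizers of the Tikhonov regularizations of a continuous, midpoint convex, coercive
functional converge in norm to a minimizer of the functional. -/
theorem exists_tendsto_tikhonov_minimizers [CompleteSpace U] {F : U → ℝ} (hF : Continuous F)
    (hconv : ∀ u v, F ((2⁻¹ : ℝ) • (u + v)) ≤ (F u + F v) / 2)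
    {a : ℝ} (ha : 0 < a) (hcoer : ∀ u, a * ‖u‖ ^ 2 ≤ F u)
    {γ : ℕ → ℝ} (hγpos : ∀ n, 0 < γ n) (hγ0 : Tendsto γ atTop (nhds 0)) {u : ℕ → U}
    (hu : ∀ n w, F (u n) + γ n / 2 * ‖u n‖ ^ 2 ≤ F w + γ n / 2 * ‖w‖ ^ 2) :
    ∃ ubar, (∀ w, F ubar ≤ F w) ∧ Tendsto u atTop (nhds ubar) := by
  have hdist : ∀ n m, γ n ≤ γ m → ‖u n - u m‖ ^ 2 ≤ 2 * (‖u n‖ ^ 2 - ‖u m‖ ^ 2) :=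
    fun n m h => norm_sub_sq_le_of_isMinimizer hconv (hγpos n) h (hu n) (hu m)
  have hbdd : BddAbove (Set.range fun n => ‖u n‖ ^ 2) := by
    refine ⟨F 0 / a, ?_⟩
    rintro _ ⟨n, rfl⟩
    have h := hu n 0
    simp only [norm_zero] at h
    have : 0 ≤ γ n / 2 * ‖u n‖ ^ 2 := mul_nonneg (by linarith [hγpos n]) (sq_nonneg _)
    rw [le_div_iff₀ ha]
    linarith [hcoer (u n)]
  have hle : ∀ n, ‖u n‖ ^ 2 ≤ ⨆ n, ‖u n‖ ^ 2 := le_ciSup hbdd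
  have hcauchy : CauchySeq u := by
    rw [Metric.cauchySeq_iff]
    intro ε hε
    obtain ⟨k, hk⟩ := exists_lt_of_lt_ciSup
      (show (⨆ n, ‖u n‖ ^ 2) - ε ^ 2 / 2 < ⨆ n, ‖u n‖ ^ 2 by linarith [pow_pos hε 2])
    obtain ⟨M, hM⟩ := eventually_atTop.1 (hγ0.eventually (gt_mem_nhds (hγpos k)))
    have key : ∀ m ≥ M, ∀ n ≥ M, γ m ≤ γ n → dist (u m) (u n) < ε := by
      intro m _ n hn hmn
      rw [dist_eq_norm]
      refine lt_of_pow_lt_pow_left₀ 2 hε.le ?_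
      have h₁ := hdist n k (hM n hn).le
      linarith [hdist m n hmn, hle m, sq_nonneg ‖u n - u k‖]
    refine ⟨M, fun m hm n hn => ?_⟩
    rcases le_total (γ m) (γ n) with h | h
    · exact key m hm n hn h
    · rw [dist_comm]
      exact key n hn m hm h
  obtain ⟨ubar, hubar⟩ := cauchySeq_tendsto_of_complete hcauchy
  refine ⟨ubar, fun w => ?_, hubar⟩
  have hlim : Tendsto (fun n => F w + γ n / 2 * ‖w‖ ^ 2) atTop (nhds (F w)) := by
    simpa using ((hγ0.div_const 2).mul_const (‖w‖ ^ 2)).const_add (F w)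
  refine le_of_tendsto_of_tendsto' ((hF.tendsto ubar).comp hubar) hlim fun n => ?_
  have : 0 ≤ γ n / 2 * ‖u n‖ ^ 2 := mul_nonneg (by linarith [hγpos n]) (sq_nonneg _)
  simp only [Function.comp_apply]
  linarith [hu n w]

end Tikhonov

section SumAbs

variable {ι : Type*} [Fintype ι]

theorem lipschitzWith_sum_abs :
    LipschitzWith (Fintype.card ι) fun x : EuclideanSpace ℝ ι => ∑ i, |x i| := by
  refine LipschitzWith.of_dist_le_mul fun x y => ?_
  rw [Real.dist_eq, ← Finset.sum_sub_distrib, dist_eq_norm]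
  calc |∑ i, (|x i| - |y i|)| ≤ ∑ i, |(|x i| - |y i|)| := Finset.abs_sum_le_sum_abs _ _
    _ ≤ ∑ _i : ι, ‖x - y‖ := Finset.sum_le_sum fun i _ =>
        (abs_abs_sub_abs_le_abs_sub _ _).trans (PiLp.norm_apply_le (x - y) i)
    _ = _ := by simp

theorem EuclideanSpace.norm_le_sum_abs (x : EuclideanSpace ℝ ι) : ‖x‖ ≤ ∑ i, |x i| := by
  refine le_of_sq_le_sq ?_ (Finset.sum_nonneg fun i _ => abs_nonneg _)
  rw [EuclideanSpace.norm_sq_eq]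
  exact Finset.sum_sq_le_sq_sum_of_nonneg fun i _ => norm_nonneg _

variable {X : Type*} [MeasurableSpace X] {μ : Measure X}

/-- The pointwise `ℓ¹` norm of an `L²` function with values in a Euclidean space. -/
noncomputable def sumAbsLp (u : Lp (EuclideanSpace ℝ ι) 2 μ) : Lp ℝ 2 μ :=
  lipschitzWith_sum_abs.compLp (by simp) u

theorem coeFn_sumAbsLp (u : Lp (EuclideanSpace ℝ ι) 2 μ) :
    sumAbsLp u =ᵐ[μ] fun t => ∑ i, |u t i| :=
  lipschitzWith_sum_abs.coeFn_compLp (by simp) u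

theorem continuous_sumAbsLp :
    Continuous (sumAbsLp : Lp (EuclideanSpace ℝ ι) 2 μ → Lp ℝ 2 μ) :=
  lipschitzWith_sum_abs.continuous_compLp (by simp)

theorem norm_sumAbsLp_sq (u : Lp (EuclideanSpace ℝ ι) 2 μ) :
    ‖sumAbsLp u‖ ^ 2 = ∫ t, (∑ i, |u t i|) ^ 2 ∂μ := by
  rw [← real_inner_self_eq_norm_sq, L2.inner_def]
  refine integral_congr_ae ?_
  filter_upwards [coeFn_sumAbsLp u] with t ht
  rw [real_inner_self_eq_norm_sq, ht, Real.norm_eq_abs, sq_abs]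

theorem norm_le_norm_sumAbsLp (u : Lp (EuclideanSpace ℝ ι) 2 μ) : ‖u‖ ≤ ‖sumAbsLp u‖ := by
  refine Lp.norm_le_norm_of_ae_le ?_
  filter_upwards [coeFn_sumAbsLp u] with t ht
  rw [ht]
  exact (EuclideanSpace.norm_le_sum_abs _).trans (le_abs_self _)

theorem norm_sumAbsLp_half_smul_add_le (u v : Lp (EuclideanSpace ℝ ι) 2 μ) :
    ‖sumAbsLp ((2⁻¹ : ℝ) • (u + v))‖ ≤ ‖(2⁻¹ : ℝ) • (sumAbsLp u + sumAbsLp v)‖ := by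
  refine Lp.norm_le_norm_of_ae_le ?_
  filter_upwards [coeFn_sumAbsLp u, coeFn_sumAbsLp v, coeFn_sumAbsLp ((2⁻¹ : ℝ) • (u + v)),
    Lp.coeFn_smul (2⁻¹ : ℝ) (u + v), Lp.coeFn_add u v,
    Lp.coeFn_smul (2⁻¹ : ℝ) (sumAbsLp u + sumAbsLp v),
    Lp.coeFn_add (sumAbsLp u) (sumAbsLp v)] with t h₁ h₂ h₃ h₄ h₅ h₆ h₇
  rw [h₃, h₆, Pi.smul_apply, h₇, Pi.add_apply, h₁, h₂, h₄, Pi.smul_apply, h₅, Pi.add_apply,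
    Real.norm_eq_abs, Real.norm_eq_abs, abs_of_nonneg (Finset.sum_nonneg fun i _ => abs_nonneg _)]
  refine le_trans ?_ (le_abs_self _)
  rw [← Finset.sum_add_distrib, smul_eq_mul, Finset.mul_sum]
  refine Finset.sum_le_sum fun i _ => ?_
  simp only [PiLp.smul_apply, PiLp.add_apply, smul_eq_mul, abs_mul]
  rw [abs_of_pos (by norm_num : (0 : ℝ) < 2⁻¹)]
  gcongr
  exact abs_add_le _ _

end SumAbs

/-- Convergence of Tikhonov-regularized minimizers: if `u_γₙ` minimizes
`J_γₙ(u) = J(u) + (γₙ/2)‖u‖_U²` with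
`J(u) = (1/2)‖K u + c - y^d‖² + (α/2)∫₀ᵀ (∑ i, |u_i(t)|)² dt` and `γₙ → 0`,
`γₙ > 0`, then `(u_γₙ)` converges weakly in `U = L²((0,T); ℝ^N)` to a
minimizer `ū` of `J`. -/
theorem weak_convergence_of_regularized_minimizers
    (T : ℝ) (hT : 0 < T) (N : ℕ) (hN : 0 < N) (α : ℝ) (hα : 0 < α)
    (H : Type*) [NormedAddCommGroup H] [InnerProductSpace ℝ H] [CompleteSpace H]
    (K : Lp (EuclideanSpace ℝ (Fin N)) 2 (volume.restrict (Set.Ioo (0:ℝ) T)) →L[ℝ] H)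
    (c yd : H)
    (γ : ℕ → ℝ) (hγpos : ∀ n, 0 < γ n) (hγ0 : Tendsto γ atTop (nhds 0))
    (u : ℕ → Lp (EuclideanSpace ℝ (Fin N)) 2 (volume.restrict (Set.Ioo (0:ℝ) T)))
    (hu : ∀ n, ∀ w : Lp (EuclideanSpace ℝ (Fin N)) 2 (volume.restrict (Set.Ioo (0:ℝ) T)),
        1 / 2 * ‖K (u n) + c - yd‖ ^ 2 +
            α / 2 * (∫ t, (∑ i, |(u n) t i|) ^ 2 ∂(volume.restrict (Set.Ioo (0:ℝ) T))) +
            γ n / 2 * ‖u n‖ ^ 2 ≤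
          1 / 2 * ‖K w + c - yd‖ ^ 2 +
            α / 2 * (∫ t, (∑ i, |w t i|) ^ 2 ∂(volume.restrict (Set.Ioo (0:ℝ) T))) +
            γ n / 2 * ‖w‖ ^ 2) :
    ∃ ubar : Lp (EuclideanSpace ℝ (Fin N)) 2 (volume.restrict (Set.Ioo (0:ℝ) T)),
      (∀ w : Lp (EuclideanSpace ℝ (Fin N)) 2 (volume.restrict (Set.Ioo (0:ℝ) T)),
        1 / 2 * ‖K ubar + c - yd‖ ^ 2 +
            α / 2 * (∫ t, (∑ i, |ubar t i|) ^ 2 ∂(volume.restrict (Set.Ioo (0:ℝ) T))) ≤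
          1 / 2 * ‖K w + c - yd‖ ^ 2 +
            α / 2 * (∫ t, (∑ i, |w t i|) ^ 2 ∂(volume.restrict (Set.Ioo (0:ℝ) T)))) ∧
      ∀ w : Lp (EuclideanSpace ℝ (Fin N)) 2 (volume.restrict (Set.Ioo (0:ℝ) T)),
        Tendsto (fun n => inner (𝕜 := ℝ) (u n) w) atTop
          (nhds (inner (𝕜 := ℝ) ubar w)) := by
  simp only [← norm_sumAbsLp_sq] at hu ⊢
  have hcont : Continuous fun w : Lp (EuclideanSpace ℝ (Fin N)) 2
      (volume.restrict (Set.Ioo (0 : ℝ) T)) =>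
      1 / 2 * ‖K w + c - yd‖ ^ 2 + α / 2 * ‖sumAbsLp w‖ ^ 2 := by
    have := continuous_sumAbsLp (ι := Fin N) (μ := volume.restrict (Set.Ioo (0 : ℝ) T))
    fun_prop
  suffices h : ∃ ubar, (∀ w, 1 / 2 * ‖K ubar + c - yd‖ ^ 2 + α / 2 * ‖sumAbsLp ubar‖ ^ 2 ≤
      1 / 2 * ‖K w + c - yd‖ ^ 2 + α / 2 * ‖sumAbsLp w‖ ^ 2) ∧
      Tendsto u atTop (nhds ubar) by
    obtain ⟨ubar, hmin, hlim⟩ := h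
    exact ⟨ubar, hmin, fun w => hlim.inner tendsto_const_nhds⟩
  refine exists_tendsto_tikhonov_minimizers hcont (fun v w => ?_) (half_pos hα) (fun w => ?_)
    hγpos hγ0 hu
  · have hK : K ((2⁻¹ : ℝ) • (v + w)) + c - yd =
        (2⁻¹ : ℝ) • ((K v + c - yd) + (K w + c - yd)) := by
      rw [map_smul, map_add]
      module
    have h₁ := norm_half_smul_add_sq (K v + c - yd) (K w + c - yd)
    have h₂ := pow_le_pow_left₀ (norm_nonneg _) (norm_sumAbsLp_half_smul_add_le v w) 2
    rw [norm_half_smul_add_sq] at h₂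
    have h₃ : ‖sumAbsLp ((2⁻¹ : ℝ) • (v + w))‖ ^ 2 ≤
        (‖sumAbsLp v‖ ^ 2 + ‖sumAbsLp w‖ ^ 2) / 2 := by
      linarith [sq_nonneg ‖sumAbsLp v - sumAbsLp w‖]
    have h₄ := mul_le_mul_of_nonneg_left h₃ (half_pos hα).le
    simp only [hK]
    linarith [sq_nonneg ‖(K v + c - yd) - (K w + c - yd)‖]
  · have h := mul_le_mul_of_nonneg_left
      (pow_le_pow_left₀ (norm_nonneg _) (norm_le_norm_sumAbsLp w) 2) (half_pos hα).le
    linarith [sq_nonneg ‖K w + c - yd‖]
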